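/- (Extended Plücker relation in the general case, Lemma 5.4, summed form, equation (7).) With the setup and definitions of s₁, s₂, ŝ₂, s₃, ŝ₃ given in the context: ((k−r)² + (k−c)² + (r−c)²) · [S_R,S_C]·[T_R,T_C] = 2·s₁ − 2(k−1+r−2c)·ŝ₂ − 2(k−1+c−2r)·s₂ − 4(s₃ + ŝ₃). -/

import Mathlib

open Finset

/-- The determinant of the square submatrix of `A` with rows `R` (in increasing order)
and columns `C` (in increasing order); junk value `0` if `R.card ≠ C.card`. -/
noncomputable def subdet {m n : ℕ} (A : Matrix (Fin m) (Fin n) ℝ)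
    (R : Finset (Fin m)) (C : Finset (Fin n)) : ℝ :=
  if h : R.card = C.card then
    (A.submatrix (R.orderEmbOfFin rfl) (C.orderEmbOfFin h.symm)).det
  else 0

open Sum Equiv

section Exchange

variable {m ι : Type*} [DecidableEq ι]

/-- Exchanges the entry at `a` of the first tuple with the entry at `b` of the second. -/
abbrev exchange (a b : ι) : Perm (ι ⊕ ι) := swap (inl a) (inr b)

lemma comp_exchange_comp_inl (w : ι ⊕ ι → m) (a b : ι) :
    (w ∘ exchange a b) ∘ inl = Function.update (w ∘ inl) a (w (inr b)) := by
  ext x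
  by_cases h : x = a
  · subst h; simp
  · simp [h, swap_apply_of_ne_of_ne]

lemma comp_exchange_comp_inr (w : ι ⊕ ι → m) (a b : ι) :
    (w ∘ exchange a b) ∘ inr = Function.update (w ∘ inr) b (w (inl a)) := by
  ext x
  by_cases h : x = b
  · subst h; simp
  · simp [h, swap_apply_of_ne_of_ne]

lemma exchange_mul_exchange_of_left_eq (a : ι) {b b' : ι} (h : b ≠ b') :
    exchange a b * exchange a b' = exchange a b' * Perm.sumCongr 1 (swap b b') := by
  rw [Perm.sumCongr_one_swap, mul_swap_eq_swap_mul (exchange a b') (inr b),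
    swap_apply_of_ne_of_ne (by simp) (by simpa), swap_apply_right, swap_comm (inr b)]

lemma exchange_mul_exchange_of_right_eq {a a' : ι} (b : ι) (h : a ≠ a') :
    exchange a b * exchange a' b = exchange a' b * Perm.sumCongr (swap a a') 1 := by
  rw [Perm.sumCongr_swap_one, mul_swap_eq_swap_mul (exchange a' b) (inl a),
    swap_apply_of_ne_of_ne (by simpa) (by simp), swap_apply_left]

lemma exchange_mul_exchange_swap {a a' b b' : ι} (ha : a ≠ a') (hb : b ≠ b') :
    exchange a' b * exchange a b' =
      exchange a b * exchange a' b' * Perm.sumCongr (swap a a') (swap b b') := by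
  ext x
  rcases x with x | x <;>
    simp only [Perm.mul_apply, Perm.sumCongr_apply, Sum.map_inl, Sum.map_inr, swap_apply_def] <;>
    grind

lemma comp_exchange_eq_of_notMem {w : ι ⊕ ι → m} {K : Finset ι}
    (hw : ∀ a ∉ K, w (inl a) = w (inr a)) {a b : ι} (ha : a ∈ K) (hb : b ∈ K) :
    ∀ x ∉ K, (w ∘ exchange a b) (inl x) = (w ∘ exchange a b) (inr x) := by
  intro x hx
  have h₁ : x ≠ a := fun h => hx (h ▸ ha)
  have h₂ : x ≠ b := fun h => hx (h ▸ hb)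
  simp [swap_apply_of_ne_of_ne, h₁, h₂, hw x hx]

end Exchange

section PairDet

variable {m n ι : Type*} [Fintype ι] [DecidableEq ι]

/-- The product of the two minors of `A` selected by a pair of row tuples `w` and a pair of
column tuples `z`. -/
def pairDet (A : Matrix m n ℝ) (w : ι ⊕ ι → m) (z : ι ⊕ ι → n) : ℝ :=
  (A.submatrix (w ∘ inl) (z ∘ inl)).det * (A.submatrix (w ∘ inr) (z ∘ inr)).det

lemma pairDet_transpose (A : Matrix m n ℝ) (w : ι ⊕ ι → m) (z : ι ⊕ ι → n) :
    pairDet A.transpose z w = pairDet A w z := by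
  simp only [pairDet, ← Matrix.transpose_submatrix, Matrix.det_transpose]

lemma det_submatrix_update (A : Matrix m n ℝ) (u : ι → m) (p : ι → n) (a : ι) (x : m) :
    (A.submatrix (Function.update u a x) p).det =
      ∑ j, (A.submatrix u p).adjugate j a * A x (p j) := by
  have : A.submatrix (Function.update u a x) p =
      (A.submatrix u p).updateRow a (fun j => A x (p j)) := by
    ext i j
    by_cases h : i = a
    · subst h; simp
    · simp [h]
  rw [this, ← Matrix.cramer_transpose_apply, Matrix.cramer_eq_adjugate_mulVec,
    ← Matrix.adjugate_transpose]
  rfl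

lemma det_submatrix_update_right (A : Matrix m n ℝ) (u : ι → m) (p : ι → n) (a : ι) (y : n) :
    (A.submatrix u (Function.update p a y)).det =
      ∑ j, (A.submatrix u p).adjugate a j * A (u j) y := by
  rw [← Matrix.det_transpose, Matrix.transpose_submatrix, det_submatrix_update]
  simp only [← Matrix.transpose_submatrix, ← Matrix.adjugate_transpose, Matrix.transpose_apply]

/-- Summing over all row exchanges gives the same as summing over all column exchanges. -/
lemma sum_pairDet_exchange_rows_eq_columns (A : Matrix m n ℝ) (w : ι ⊕ ι → m)
    (z : ι ⊕ ι → n) :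
    ∑ a, ∑ b, pairDet A (w ∘ exchange a b) z = ∑ a, ∑ b, pairDet A w (z ∘ exchange a b) := by
  simp only [pairDet, comp_exchange_comp_inl, comp_exchange_comp_inr, det_submatrix_update,
    det_submatrix_update_right, Finset.sum_mul_sum, Function.comp_apply]
  calc _ = ∑ a, ∑ j, ∑ b, ∑ l, _ := Finset.sum_congr rfl fun a _ => Finset.sum_comm
    _ = ∑ j, ∑ a, ∑ b, ∑ l, _ := Finset.sum_comm
    _ = ∑ j, ∑ a, ∑ l, ∑ b, _ :=
        Finset.sum_congr rfl fun j _ => Finset.sum_congr rfl fun a _ => Finset.sum_comm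
    _ = ∑ j, ∑ l, ∑ a, ∑ b, _ := Finset.sum_congr rfl fun j _ => Finset.sum_comm
    _ = _ := by
      refine Finset.sum_congr rfl fun j _ => Finset.sum_congr rfl fun l _ =>
        Finset.sum_congr rfl fun a _ => Finset.sum_congr rfl fun b _ => ?_
      ring

lemma pairDet_comp_sumCongr (A : Matrix m n ℝ) (w : ι ⊕ ι → m) (z : ι ⊕ ι → n)
    (σ ρ : Perm ι) :
    pairDet A (w ∘ Perm.sumCongr σ ρ) z = Perm.sign σ * Perm.sign ρ * pairDet A w z := by
  have h₁ : A.submatrix ((w ∘ Perm.sumCongr σ ρ) ∘ inl) (z ∘ inl) =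
      (A.submatrix (w ∘ inl) (z ∘ inl)).submatrix σ id := rfl
  have h₂ : A.submatrix ((w ∘ Perm.sumCongr σ ρ) ∘ inr) (z ∘ inr) =
      (A.submatrix (w ∘ inr) (z ∘ inr)).submatrix ρ id := rfl
  rw [pairDet, pairDet, h₁, h₂, Matrix.det_permute, Matrix.det_permute]
  ring

/-- The sum of `pairDet` over all row exchanges at positions in `K`. -/
def rowExchangeSum (K : Finset ι) (A : Matrix m n ℝ) (w : ι ⊕ ι → m) (z : ι ⊕ ι → n) : ℝ :=
  ∑ a ∈ K, ∑ b ∈ K, pairDet A (w ∘ exchange a b) z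

/-- The sum of `pairDet` over all column exchanges at positions in `K`. -/
def colExchangeSum (K : Finset ι) (A : Matrix m n ℝ) (w : ι ⊕ ι → m) (z : ι ⊕ ι → n) : ℝ :=
  ∑ a ∈ K, ∑ b ∈ K, pairDet A w (z ∘ exchange a b)

/-- The sum of `pairDet` over all ordered pairs of disjoint row exchanges at positions in `K`. -/
def rowDoubleExchangeSum (K : Finset ι) (A : Matrix m n ℝ) (w : ι ⊕ ι → m)
    (z : ι ⊕ ι → n) : ℝ :=
  ∑ a ∈ K, ∑ b ∈ K, ∑ a' ∈ K, ∑ b' ∈ K,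
    if a ≠ a' ∧ b ≠ b' then pairDet A ((w ∘ exchange a b) ∘ exchange a' b') z else 0

lemma pairDet_comp_exchange_of_eq {A : Matrix m n ℝ} {w : ι ⊕ ι → m} {z : ι ⊕ ι → n}
    {K : Finset ι} (hw : ∀ a ∉ K, w (inl a) = w (inr a)) (a b : ι) :
    pairDet A (w ∘ exchange a b) z =
      (if a ∈ K then if b ∈ K then pairDet A (w ∘ exchange a b) z else 0 else 0) +
        if a ∈ Kᶜ then if a = b then pairDet A w z else 0 else 0 := by
  by_cases hab : a = b
  · subst hab
    by_cases ha : a ∈ K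
    · simp [ha]
    · have : w ∘ exchange a a = w := by
        ext x
        by_cases h₁ : x = inl a
        · subst h₁; simp [hw a ha]
        · by_cases h₂ : x = inr a
          · subst h₂; simp [hw a ha]
          · simp [swap_apply_of_ne_of_ne h₁ h₂]
      simp [ha, this]
  by_cases ha : a ∈ K
  · by_cases hb : b ∈ K
    · simp [ha, hb]
    · have : (A.submatrix ((w ∘ exchange a b) ∘ inl) (z ∘ inl)).det = 0 := by
        rw [comp_exchange_comp_inl]
        apply Matrix.det_zero_of_row_eq hab
        ext j
        simp [Function.update_of_ne (Ne.symm hab), hw b hb]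
      simp [ha, hb, pairDet, this]
  · have : (A.submatrix ((w ∘ exchange a b) ∘ inr) (z ∘ inr)).det = 0 := by
      rw [comp_exchange_comp_inr]
      apply Matrix.det_zero_of_row_eq hab
      ext j
      simp [Function.update_of_ne hab, hw a ha]
    simp [ha, hab, pairDet, this]

lemma sum_pairDet_exchange_of_eq {A : Matrix m n ℝ} {w : ι ⊕ ι → m} {z : ι ⊕ ι → n}
    {K : Finset ι} (hw : ∀ a ∉ K, w (inl a) = w (inr a)) :
    ∑ a, ∑ b, pairDet A (w ∘ exchange a b) z =
      rowExchangeSum K A w z + (Kᶜ.card : ℝ) * pairDet A w z := by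
  rw [Finset.sum_congr rfl fun a _ => Finset.sum_congr rfl fun b _ =>
    pairDet_comp_exchange_of_eq hw a b]
  simp_rw [Finset.sum_add_distrib]
  congr 1
  · rw [rowExchangeSum, ← Finset.sum_subset (Finset.subset_univ K)]
    · refine Finset.sum_congr rfl fun a ha => ?_
      simp [ha]
    · intro a _ ha
      simp [ha]
  · have : ∀ a : ι, (∑ b, if a ∈ Kᶜ then if a = b then pairDet A w z else 0 else 0) =
        if a ∈ Kᶜ then pairDet A w z else 0 := by
      intro a
      split_ifs <;> simp
    simp_rw [this]
    rw [Finset.sum_ite_mem]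
    simp

/-- Trading row exchanges for column exchanges. -/
lemma rowExchangeSum_add_eq_colExchangeSum_add {A : Matrix m n ℝ} {w : ι ⊕ ι → m}
    {z : ι ⊕ ι → n} {K L : Finset ι} (hw : ∀ a ∉ K, w (inl a) = w (inr a))
    (hz : ∀ a ∉ L, z (inl a) = z (inr a)) :
    rowExchangeSum K A w z + (Kᶜ.card : ℝ) * pairDet A w z =
      colExchangeSum L A w z + (Lᶜ.card : ℝ) * pairDet A w z := by
  rw [← sum_pairDet_exchange_of_eq hw, sum_pairDet_exchange_rows_eq_columns]
  have := sum_pairDet_exchange_of_eq (A := A.transpose) (z := w) hz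
  simpa only [rowExchangeSum, colExchangeSum, pairDet_transpose] using this

lemma pairDet_comp_exchange_comp_exchange (A : Matrix m n ℝ) (w : ι ⊕ ι → m) (z : ι ⊕ ι → n)
    (a b a' b' : ι) :
    pairDet A ((w ∘ exchange a b) ∘ exchange a' b') z =
      (if a = a' then if b = b' then pairDet A w z + pairDet A (w ∘ exchange a b) z +
          pairDet A (w ∘ exchange a b) z else 0 else 0)
        - (if a = a' then pairDet A (w ∘ exchange a b') z else 0)
        - (if b = b' then pairDet A (w ∘ exchange a' b) z else 0)
        + if a ≠ a' ∧ b ≠ b' then pairDet A ((w ∘ exchange a b) ∘ exchange a' b') z else 0 := by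
  by_cases ha : a = a'
  · subst ha
    by_cases hb : b = b'
    · subst hb
      have : (w ∘ exchange a b) ∘ exchange a b = w := by ext x; simp
      simp [this]
    · have : (w ∘ exchange a b) ∘ exchange a b' =
          (w ∘ exchange a b') ∘ Perm.sumCongr 1 (swap b b') := by
        rw [Function.comp_assoc, Function.comp_assoc, ← Perm.coe_mul, ← Perm.coe_mul,
          exchange_mul_exchange_of_left_eq a hb]
      rw [this, pairDet_comp_sumCongr, Perm.sign_swap hb]
      simp [hb]
  · by_cases hb : b = b'
    · subst hb
      have : (w ∘ exchange a b) ∘ exchange a' b =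
          (w ∘ exchange a' b) ∘ Perm.sumCongr (swap a a') 1 := by
        rw [Function.comp_assoc, Function.comp_assoc, ← Perm.coe_mul, ← Perm.coe_mul,
          exchange_mul_exchange_of_right_eq b ha]
      rw [this, pairDet_comp_sumCongr, Perm.sign_swap ha]
      simp [ha]
    · simp [ha, hb]

lemma sum_rowExchangeSum_exchange (K : Finset ι) (A : Matrix m n ℝ) (w : ι ⊕ ι → m)
    (z : ι ⊕ ι → n) :
    ∑ a ∈ K, ∑ b ∈ K, rowExchangeSum K A (w ∘ exchange a b) z =
      (K.card : ℝ) ^ 2 * pairDet A w z - 2 * ((K.card : ℝ) - 1) * rowExchangeSum K A w z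
        + rowDoubleExchangeSum K A w z := by
  have key : ∀ a ∈ K, ∀ b ∈ K, rowExchangeSum K A (w ∘ exchange a b) z =
      pairDet A w z + 2 * pairDet A (w ∘ exchange a b) z
        - ∑ b' ∈ K, pairDet A (w ∘ exchange a b') z
        - ∑ a' ∈ K, pairDet A (w ∘ exchange a' b) z
        + ∑ a' ∈ K, ∑ b' ∈ K,
          if a ≠ a' ∧ b ≠ b' then pairDet A ((w ∘ exchange a b) ∘ exchange a' b') z else 0 := by
    intro a ha b hb
    rw [rowExchangeSum, Finset.sum_congr rfl fun a' _ => Finset.sum_congr rfl fun b' _ =>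
      pairDet_comp_exchange_comp_exchange A w z a b a' b']
    simp_rw [Finset.sum_add_distrib, Finset.sum_sub_distrib]
    congr 1
    congr 1
    · congr 1
      · rw [Finset.sum_eq_single_of_mem a ha (by intro x _ hx; simp [Ne.symm hx])]
        simp [hb]
        ring
      · rw [Finset.sum_eq_single_of_mem a ha (by intro x _ hx; simp [Ne.symm hx])]
        simp
    · simp [hb]
  rw [Finset.sum_congr rfl fun a ha => Finset.sum_congr rfl fun b hb => key a ha b hb]
  simp_rw [Finset.sum_add_distrib, Finset.sum_sub_distrib, Finset.sum_add_distrib]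
  rw [rowDoubleExchangeSum, rowExchangeSum]
  have h : ∑ x ∈ K, ∑ y ∈ K, ∑ x' ∈ K, pairDet A (w ∘ exchange x' y) z =
      K.card * ∑ x ∈ K, ∑ y ∈ K, pairDet A (w ∘ exchange x y) z := by
    rw [Finset.sum_const, nsmul_eq_mul, Finset.sum_comm]
  rw [h]
  simp only [Finset.sum_const, nsmul_eq_mul, ← Finset.mul_sum]
  ring

/-- The quadratic exchange relation between the minors of `A`. -/
lemma exchange_relation {A : Matrix m n ℝ} {w : ι ⊕ ι → m}
    {z : ι ⊕ ι → n} {K L : Finset ι} (hw : ∀ a ∉ K, w (inl a) = w (inr a))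
    (hz : ∀ a ∉ L, z (inl a) = z (inr a)) {r c : ℝ} (hr : (Kᶜ.card : ℝ) = r)
    (hc : (Lᶜ.card : ℝ) = c) :
    ((K.card : ℝ) ^ 2 + (L.card : ℝ) ^ 2 - (r - c) ^ 2) * pairDet A w z =
      2 * ∑ a ∈ K, ∑ b ∈ K, colExchangeSum L A (w ∘ exchange a b) z
        + 2 * ((K.card : ℝ) - 1) * rowExchangeSum K A w z
        + 2 * ((L.card : ℝ) - 1) * colExchangeSum L A w z
        - rowDoubleExchangeSum K A w z - rowDoubleExchangeSum L A.transpose z w := by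
  have h₀ := rowExchangeSum_add_eq_colExchangeSum_add (A := A) hw hz
  have h₁ : ∑ a ∈ K, ∑ b ∈ K, rowExchangeSum K A (w ∘ exchange a b) z +
      r * rowExchangeSum K A w z = ∑ a ∈ K, ∑ b ∈ K, colExchangeSum L A (w ∘ exchange a b) z +
      c * rowExchangeSum K A w z := by
    simp only [rowExchangeSum.eq_1 K A w z, Finset.mul_sum, ← Finset.sum_add_distrib]
    refine Finset.sum_congr rfl fun a ha => Finset.sum_congr rfl fun b hb => ?_
    rw [← hr, ← hc]
    exact rowExchangeSum_add_eq_colExchangeSum_add (comp_exchange_eq_of_notMem hw ha hb) hz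
  have h₂ : ∑ a ∈ L, ∑ b ∈ L, rowExchangeSum K A w (z ∘ exchange a b) +
      r * colExchangeSum L A w z = ∑ a ∈ L, ∑ b ∈ L, colExchangeSum L A w (z ∘ exchange a b) +
      c * colExchangeSum L A w z := by
    simp only [colExchangeSum.eq_1 L A w z, Finset.mul_sum, ← Finset.sum_add_distrib]
    refine Finset.sum_congr rfl fun a ha => Finset.sum_congr rfl fun b hb => ?_
    rw [← hr, ← hc]
    exact rowExchangeSum_add_eq_colExchangeSum_add hw (comp_exchange_eq_of_notMem hz ha hb)
  have h₃ := sum_rowExchangeSum_exchange K A w z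
  have h₄ := sum_rowExchangeSum_exchange L A.transpose z w
  have hcol : ∀ z', rowExchangeSum L A.transpose z' w = colExchangeSum L A w z' := by
    intro z'
    simp only [rowExchangeSum, colExchangeSum, pairDet_transpose]
  simp only [hcol, pairDet_transpose] at h₄
  have h₅ : ∑ a ∈ L, ∑ b ∈ L, rowExchangeSum K A w (z ∘ exchange a b) =
      ∑ a ∈ K, ∑ b ∈ K, colExchangeSum L A (w ∘ exchange a b) z := by
    simp only [rowExchangeSum, colExchangeSum]
    calc _ = ∑ a ∈ L, ∑ a' ∈ K, ∑ b ∈ L, ∑ b' ∈ K, _ :=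
          Finset.sum_congr rfl fun a _ => Finset.sum_comm
      _ = ∑ a' ∈ K, ∑ a ∈ L, ∑ b ∈ L, ∑ b' ∈ K, _ := Finset.sum_comm
      _ = ∑ a' ∈ K, ∑ a ∈ L, ∑ b' ∈ K, ∑ b ∈ L, _ :=
          Finset.sum_congr rfl fun a' _ => Finset.sum_congr rfl fun a _ => Finset.sum_comm
      _ = _ := Finset.sum_congr rfl fun a' _ => Finset.sum_comm
  rw [h₅] at h₂
  rw [hr, hc] at h₀
  linear_combination h₁ - h₂ - h₃ - h₄ - (r - c) * h₀

end PairDet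

section Sorting

variable {k N : ℕ}

/-- The tuple `u` enumerates `R` and is put in increasing order by a permutation of sign `ε`. -/
def SortsTo (u : Fin k → Fin N) (R : Finset (Fin N)) (ε : ℝ) : Prop :=
  ∃ σ : Perm (Fin k), StrictMono (u ∘ σ) ∧ Finset.univ.image u = R ∧
    ((Perm.sign σ : ℤ) : ℝ) = ε

lemma subdet_eq_det_of_strictMono {M : ℕ} (A : Matrix (Fin M) (Fin N) ℝ) {u : Fin k → Fin M}
    {p : Fin k → Fin N} (hu : StrictMono u) (hp : StrictMono p) :
    subdet A (Finset.univ.image u) (Finset.univ.image p) = (A.submatrix u p).det := by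
  have hR : (Finset.univ.image u).card = k := by
    simp [Finset.card_image_of_injective _ hu.injective]
  have hC : (Finset.univ.image p).card = k := by
    simp [Finset.card_image_of_injective _ hp.injective]
  have hu' := Finset.orderEmbOfFin_unique hR (by simp) hu
  have hp' := Finset.orderEmbOfFin_unique hC (by simp) hp
  rw [subdet, dif_pos (hR.trans hC.symm)]
  conv_rhs => rw [hu', hp']
  generalize Finset.univ.image u = R at *
  generalize Finset.univ.image p = C at *
  subst hR
  rfl

lemma SortsTo.det_submatrix {M : ℕ} (A : Matrix (Fin M) (Fin N) ℝ) {u : Fin k → Fin M}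
    {p : Fin k → Fin N} {R : Finset (Fin M)} {C : Finset (Fin N)} {ε δ : ℝ}
    (hu : SortsTo u R ε) (hp : SortsTo p C δ) :
    (A.submatrix u p).det = ε * δ * subdet A R C := by
  obtain ⟨σ, hσ, rfl, rfl⟩ := hu
  obtain ⟨ρ, hρ, rfl, rfl⟩ := hp
  have himg : ∀ {L : ℕ} (f : Fin k → Fin L) (τ : Perm (Fin k)),
      Finset.univ.image f = Finset.univ.image (f ∘ τ) := by
    intro L f τ
    rw [← Finset.image_image, Finset.image_univ_equiv]
  have hsq : ∀ τ : Perm (Fin k), ((Perm.sign τ : ℤ) : ℝ) * ((Perm.sign τ : ℤ) : ℝ) = 1 := by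
    intro τ
    rw [← Int.cast_mul, ← Units.val_mul, Int.units_mul_self]
    simp
  have hsub : A.submatrix (u ∘ σ) (p ∘ ρ) =
      ((A.submatrix u p).submatrix σ id).submatrix id ρ := rfl
  rw [himg u σ, himg p ρ, subdet_eq_det_of_strictMono A hσ hρ, hsub, Matrix.det_permute',
    Matrix.det_permute]
  linear_combination (-(A.submatrix u p).det) * hsq σ
    - (((Perm.sign σ : ℤ) : ℝ) * ((Perm.sign σ : ℤ) : ℝ) * (A.submatrix u p).det) * hsq ρ

/-- The pair of tuples `w` enumerates `R` and `S`, with sorting permutations of total sign `ε`. -/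
def PairSortsTo (w : Fin k ⊕ Fin k → Fin N) (R S : Finset (Fin N)) (ε : ℝ) : Prop :=
  ∃ ε₁ ε₂ : ℝ, SortsTo (w ∘ inl) R ε₁ ∧ SortsTo (w ∘ inr) S ε₂ ∧ ε₁ * ε₂ = ε

lemma PairSortsTo.pairDet {M : ℕ} (A : Matrix (Fin M) (Fin N) ℝ) {w : Fin k ⊕ Fin k → Fin M}
    {z : Fin k ⊕ Fin k → Fin N} {R S : Finset (Fin M)} {C D : Finset (Fin N)} {ε δ : ℝ}
    (hw : PairSortsTo w R S ε) (hz : PairSortsTo z C D δ) :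
    pairDet A w z = ε * δ * (subdet A R C * subdet A S D) := by
  obtain ⟨ε₁, ε₂, h₁, h₂, rfl⟩ := hw
  obtain ⟨δ₁, δ₂, h₃, h₄, rfl⟩ := hz
  rw [_root_.pairDet, h₁.det_submatrix A h₃, h₂.det_submatrix A h₄]
  ring

lemma coe_cycleIcc_apply {i j : Fin k} (hij : i ≤ j) (x : Fin k) :
    (Fin.cycleIcc i j x : ℕ) =
      if (x : ℕ) < i then (x : ℕ) else if (x : ℕ) < j then (x : ℕ) + 1 else
        if (x : ℕ) = j then (i : ℕ) else x := by
  have : NeZero k := ⟨by have := x.isLt; omega⟩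
  split_ifs with h₁ h₂ h₃
  · rw [Fin.cycleIcc_of_lt h₁]
  · rw [Fin.cycleIcc_of_ge_of_lt (by simpa using h₁) h₂]
    have := j.isLt
    rw [Fin.val_add_one_of_lt' (by omega)]
  · rw [Fin.ext h₃, Fin.cycleIcc_of_last hij]
  · rw [Fin.cycleIcc_of_gt (by rw [Fin.lt_def]; omega)]

lemma coe_cycleIcc_symm_apply {i j : Fin k} (hij : i ≤ j) (x : Fin k) :
    ((Fin.cycleIcc i j).symm x : ℕ) =
      if (x : ℕ) < i then (x : ℕ) else if (x : ℕ) = i then (j : ℕ) else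
        if (x : ℕ) ≤ j then (x : ℕ) - 1 else x := by
  have h := coe_cycleIcc_apply hij ((Fin.cycleIcc i j).symm x)
  rw [Equiv.apply_symm_apply] at h
  rw [Fin.le_def] at hij
  generalize ((Fin.cycleIcc i j).symm x : ℕ) = y at *
  split_ifs at h ⊢ <;> omega

lemma image_update_of_injective {α β : Type*} [Fintype α] [DecidableEq α] [DecidableEq β]
    {u : α → β} (hu : Function.Injective u) (a : α) (x : β) :
    Finset.univ.image (Function.update u a x) =
      insert x ((Finset.univ.image u).erase (u a)) := by
  ext y
  simp only [Finset.mem_image, Finset.mem_univ, true_and, Finset.mem_insert, Finset.mem_erase,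
    Function.update_apply]
  grind

/-- The index `a` in the first half of `Fin (2 * k)`. -/
def lowerIndex (k : ℕ) : Fin k ↪ Fin (2 * k) :=
  ⟨fun a => ⟨a, by omega⟩, fun a b h => by simpa [Fin.ext_iff] using h⟩

/-- The index `k + a` in the second half of `Fin (2 * k)`. -/
def upperIndex (k : ℕ) : Fin k ↪ Fin (2 * k) :=
  ⟨fun a => ⟨k + a, by omega⟩, fun a b h => by simpa [Fin.ext_iff] using h⟩

@[simp] lemma coe_lowerIndex (a : Fin k) : (lowerIndex k a : ℕ) = a := rfl

@[simp] lemma coe_upperIndex (a : Fin k) : (upperIndex k a : ℕ) = k + a := rfl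

/-- The increasing enumeration of `{0, …, r - 1} ∪ {k + r, …, 2 * k - 1}`. -/
def mixedIndex (k r : ℕ) (b : Fin k) : Fin (2 * k) :=
  if (b : ℕ) < r then lowerIndex k b else upperIndex k b

lemma coe_mixedIndex (r : ℕ) (b : Fin k) :
    (mixedIndex k r b : ℕ) = if (b : ℕ) < r then (b : ℕ) else k + b := by
  rw [mixedIndex]
  split_ifs <;> simp

lemma mixedIndex_of_le {r : ℕ} {b : Fin k} (hb : r ≤ b) : mixedIndex k r b = upperIndex k b :=
  if_neg (by omega)

lemma strictMono_lowerIndex : StrictMono (lowerIndex k) := fun _ _ h => h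

lemma strictMono_mixedIndex (r : ℕ) : StrictMono (mixedIndex k r) := by
  intro x y h
  rw [Fin.lt_def] at *
  simp only [coe_mixedIndex]
  split_ifs <;> omega

lemma image_lowerIndex {S : Finset (Fin (2 * k))} (hS : ∀ x, x ∈ S ↔ (x : ℕ) < k) :
    Finset.univ.image (lowerIndex k) = S := by
  ext x
  simp only [Finset.mem_image, Finset.mem_univ, true_and, hS]
  constructor
  · rintro ⟨a, rfl⟩
    exact a.isLt
  · exact fun h => ⟨⟨x, h⟩, rfl⟩

lemma image_mixedIndex {r : ℕ} (hr : r ≤ k) {T : Finset (Fin (2 * k))}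
    (hT : ∀ x, x ∈ T ↔ (x : ℕ) < r ∨ k + r ≤ (x : ℕ)) :
    Finset.univ.image (mixedIndex k r) = T := by
  ext x
  simp only [Finset.mem_image, Finset.mem_univ, true_and, hT]
  constructor
  · rintro ⟨a, rfl⟩
    rw [coe_mixedIndex]
    split_ifs <;> omega
  · rintro (h | h)
    · exact ⟨⟨x, by omega⟩, Fin.ext (by simp [coe_mixedIndex, h])⟩
    · refine ⟨⟨x - k, by omega⟩, Fin.ext ?_⟩
      rw [coe_mixedIndex]
      dsimp only
      split_ifs <;> omega

lemma coe_update {α : Type*} [DecidableEq α] (u : α → Fin N) (a : α) (y : Fin N) (x : α) :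
    (Function.update u a y x : ℕ) = if x = a then (y : ℕ) else u x := by
  rw [Function.update_apply]
  split_ifs <;> rfl

lemma sign_cycleIcc_cast {i j : Fin k} (hij : i ≤ j) :
    ((Perm.sign (Fin.cycleIcc i j) : ℤ) : ℝ) = (-1) ^ (j - i : ℕ) := by
  rw [Fin.sign_cycleIcc_of_le hij]
  simp

lemma sortsTo_update_lowerIndex {S : Finset (Fin (2 * k))} (hS : ∀ x, x ∈ S ↔ (x : ℕ) < k)
    (a b : Fin k) :
    SortsTo (Function.update (lowerIndex k) a (upperIndex k b))
      (symmDiff S {lowerIndex k a, upperIndex k b}) ((-1) ^ (k - 1 - a : ℕ)) := by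
  have hk : k - 1 < k := Nat.sub_lt a.pos one_pos
  have ha : a ≤ (⟨k - 1, hk⟩ : Fin k) := by rw [Fin.le_def]; simp; omega
  refine ⟨Fin.cycleIcc a ⟨k - 1, hk⟩, ?_, ?_, sign_cycleIcc_cast ha⟩
  · intro x y h
    rw [Fin.lt_def] at *
    simp only [Function.comp_apply, coe_update, coe_lowerIndex, coe_upperIndex, Fin.ext_iff,
      coe_cycleIcc_apply ha]
    split_ifs <;> omega
  · rw [image_update_of_injective (lowerIndex k).injective, image_lowerIndex hS]
    ext x
    simp only [Finset.mem_insert, Finset.mem_erase, Finset.mem_symmDiff, Finset.mem_singleton, hS,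
      Fin.ext_iff, coe_lowerIndex, coe_upperIndex, ne_eq]
    omega

lemma sortsTo_update_mixedIndex {r : ℕ} (hr : r ≤ k) {T : Finset (Fin (2 * k))}
    (hT : ∀ x, x ∈ T ↔ (x : ℕ) < r ∨ k + r ≤ (x : ℕ)) {a b : Fin k} (ha : r ≤ a) (hb : r ≤ b) :
    SortsTo (Function.update (mixedIndex k r) b (lowerIndex k a))
      (symmDiff T {lowerIndex k a, upperIndex k b}) ((-1) ^ (b - r : ℕ)) := by
  have hrb : (⟨r, by omega⟩ : Fin k) ≤ b := hb
  refine ⟨(Fin.cycleIcc ⟨r, by omega⟩ b).symm, ?_, ?_, ?_⟩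
  · intro x y h
    rw [Fin.lt_def] at *
    simp only [Function.comp_apply, coe_update, coe_lowerIndex, coe_mixedIndex, Fin.ext_iff,
      coe_cycleIcc_symm_apply hrb]
    split_ifs <;> omega
  · rw [image_update_of_injective (strictMono_mixedIndex r).injective, image_mixedIndex hr hT,
      mixedIndex_of_le hb]
    ext x
    simp only [Finset.mem_insert, Finset.mem_erase, Finset.mem_symmDiff, Finset.mem_singleton, hT,
      Fin.ext_iff, coe_lowerIndex, coe_upperIndex, ne_eq]
    omega
  · rw [Perm.sign_symm]
    exact sign_cycleIcc_cast hrb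

lemma sortsTo_update_update_lowerIndex {S : Finset (Fin (2 * k))}
    (hS : ∀ x, x ∈ S ↔ (x : ℕ) < k) {a a' b b' : Fin k} (ha : a < a') (hb : b < b') :
    SortsTo (Function.update (Function.update (lowerIndex k) a (upperIndex k b)) a'
        (upperIndex k b'))
      (symmDiff S {lowerIndex k a, lowerIndex k a', upperIndex k b, upperIndex k b'})
      ((-1) ^ (a + a' + 1 : ℕ)) := by
  rw [Fin.lt_def] at ha hb
  have h₁ : a' ≤ (⟨k - 1, by omega⟩ : Fin k) := by rw [Fin.le_def]; simp; omega
  have h₂ : a ≤ (⟨k - 2, by omega⟩ : Fin k) := by rw [Fin.le_def]; simp; omega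
  have hmono : StrictMono (Function.update (Function.update (lowerIndex k) a (upperIndex k b)) a'
      (upperIndex k b') ∘ (Fin.cycleIcc a' ⟨k - 1, by omega⟩ *
        Fin.cycleIcc a ⟨k - 2, by omega⟩ : Perm (Fin k))) := by
    have hval : ∀ x, (((Function.update (Function.update (lowerIndex k) a (upperIndex k b)) a'
      (upperIndex k b') ∘ (Fin.cycleIcc a' ⟨k - 1, by omega⟩ *
        Fin.cycleIcc a ⟨k - 2, by omega⟩ : Perm (Fin k))) x : Fin (2 * k)) : ℕ) =
        if (x : ℕ) < a then (x : ℕ) else if (x : ℕ) + 1 < a' then x + 1 else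
          if (x : ℕ) + 2 < k then x + 2 else if (x : ℕ) + 2 = k then k + b else k + b' := by
      intro x
      simp only [Function.comp_apply, coe_update, coe_lowerIndex, coe_upperIndex, Fin.ext_iff,
        Perm.mul_apply]
      have hx₁ := coe_cycleIcc_apply h₂ x
      have hx₂ := coe_cycleIcc_apply h₁ (Fin.cycleIcc a ⟨k - 2, by omega⟩ x)
      generalize (Fin.cycleIcc a' ⟨k - 1, _⟩ (Fin.cycleIcc a ⟨k - 2, _⟩ x) : ℕ) = x₂ at *
      generalize (Fin.cycleIcc a ⟨k - 2, _⟩ x : ℕ) = x₁ at *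
      dsimp only at hx₁ hx₂
      split_ifs at hx₁ <;> split_ifs at hx₂ <;> split_ifs <;> omega
    intro x y h
    rw [Fin.lt_def] at *
    rw [hval, hval]
    split_ifs <;> omega
  refine ⟨_, hmono, ?_, ?_⟩
  · rw [image_update_of_injective, image_update_of_injective (lowerIndex k).injective,
      image_lowerIndex hS]
    · ext x
      simp only [Finset.mem_insert, Finset.mem_erase, Finset.mem_symmDiff, Finset.mem_singleton,
        hS, Fin.ext_iff, coe_lowerIndex, coe_upperIndex, coe_update, ne_eq]
      split_ifs <;> omega
    · intro x y h
      simp only [Fin.ext_iff, coe_lowerIndex, coe_upperIndex, coe_update] at h ⊢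
      split_ifs at h <;> omega
  · rw [Perm.sign_mul, Units.val_mul, Int.cast_mul, sign_cycleIcc_cast h₁, sign_cycleIcc_cast h₂,
      ← pow_add]
    apply neg_one_pow_congr
    simp only [Nat.even_iff]
    omega

set_option maxHeartbeats 1000000 in
lemma sortsTo_update_update_mixedIndex {r : ℕ} (hr : r ≤ k) {T : Finset (Fin (2 * k))}
    (hT : ∀ x, x ∈ T ↔ (x : ℕ) < r ∨ k + r ≤ (x : ℕ)) {a a' b b' : Fin k} (hra : r ≤ a)
    (hrb : r ≤ b) (ha : a < a') (hb : b < b') :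
    SortsTo (Function.update (Function.update (mixedIndex k r) b (lowerIndex k a)) b'
        (lowerIndex k a'))
      (symmDiff T {lowerIndex k a, lowerIndex k a', upperIndex k b, upperIndex k b'})
      ((-1) ^ (b + b' + 1 : ℕ)) := by
  rw [Fin.lt_def] at ha hb
  have h₁ : (⟨r, by omega⟩ : Fin k) ≤ b := hrb
  have h₂ : (⟨r + 1, by omega⟩ : Fin k) ≤ b' := by rw [Fin.le_def]; simp; omega
  have hmono : StrictMono (Function.update (Function.update (mixedIndex k r) b (lowerIndex k a))
      b' (lowerIndex k a') ∘ ((Fin.cycleIcc ⟨r, by omega⟩ b).symm *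
        (Fin.cycleIcc ⟨r + 1, by omega⟩ b').symm : Perm (Fin k))) := by
    have hval : ∀ x, (((Function.update (Function.update (mixedIndex k r) b (lowerIndex k a))
      b' (lowerIndex k a') ∘ ((Fin.cycleIcc ⟨r, by omega⟩ b).symm *
        (Fin.cycleIcc ⟨r + 1, by omega⟩ b').symm : Perm (Fin k))) x : Fin (2 * k)) : ℕ) =
        if (x : ℕ) < r then (x : ℕ) else if (x : ℕ) = r then a else
          if (x : ℕ) = r + 1 then a' else if (x : ℕ) < b + 2 then k + x - 2 else
            if (x : ℕ) ≤ b' then k + x - 1 else k + x := by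
      intro x
      simp only [Function.comp_apply, coe_update, coe_lowerIndex, coe_mixedIndex, Fin.ext_iff,
        Perm.mul_apply]
      have hx₁ := coe_cycleIcc_symm_apply h₂ x
      have hx₂ := coe_cycleIcc_symm_apply h₁ ((Fin.cycleIcc ⟨r + 1, by omega⟩ b').symm x)
      generalize ((Fin.cycleIcc ⟨r, _⟩ b).symm
        ((Fin.cycleIcc ⟨r + 1, _⟩ b').symm x) : ℕ) = x₂ at *
      generalize ((Fin.cycleIcc ⟨r + 1, _⟩ b').symm x : ℕ) = x₁ at *
      dsimp only at hx₁ hx₂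
      split_ifs at hx₁ <;> split_ifs at hx₂ <;> split_ifs <;> omega
    intro x y h
    rw [Fin.lt_def] at *
    rw [hval, hval]
    split_ifs <;> omega
  refine ⟨_, hmono, ?_, ?_⟩
  · rw [image_update_of_injective,
      image_update_of_injective (strictMono_mixedIndex r).injective,
      image_mixedIndex hr hT]
    · ext x
      simp only [Finset.mem_insert, Finset.mem_erase, Finset.mem_symmDiff, Finset.mem_singleton,
        hT, Fin.ext_iff, coe_lowerIndex, coe_upperIndex, coe_update, coe_mixedIndex, ne_eq]
      split_ifs <;> omega
    · intro x y h
      simp only [Fin.ext_iff, coe_lowerIndex, coe_mixedIndex, coe_update] at h ⊢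
      split_ifs at h <;> omega
  · rw [Perm.sign_mul, Units.val_mul, Int.cast_mul, Perm.sign_symm, Perm.sign_symm,
      sign_cycleIcc_cast h₁, sign_cycleIcc_cast h₂, ← pow_add]
    apply neg_one_pow_congr
    simp only [Nat.even_iff]
    omega

/-- The increasing enumerations of `{0, …, k - 1}` and
`{0, …, r - 1} ∪ {k + r, …, 2 * k - 1}`. -/
def pairIndex (k r : ℕ) : Fin k ⊕ Fin k → Fin (2 * k) :=
  Sum.elim (lowerIndex k) (mixedIndex k r)

lemma pairSortsTo_pairIndex {r : ℕ} (hr : r ≤ k) {S T : Finset (Fin (2 * k))}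
    (hS : ∀ x, x ∈ S ↔ (x : ℕ) < k) (hT : ∀ x, x ∈ T ↔ (x : ℕ) < r ∨ k + r ≤ (x : ℕ)) :
    PairSortsTo (pairIndex k r) S T 1 :=
  ⟨1, 1, ⟨1, strictMono_lowerIndex, image_lowerIndex hS, by simp⟩,
    ⟨1, strictMono_mixedIndex r, image_mixedIndex hr hT, by simp⟩, one_mul 1⟩

lemma pairSortsTo_pairIndex_exchange {r : ℕ} (hr : r ≤ k) {S T : Finset (Fin (2 * k))}
    (hS : ∀ x, x ∈ S ↔ (x : ℕ) < k) (hT : ∀ x, x ∈ T ↔ (x : ℕ) < r ∨ k + r ≤ (x : ℕ))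
    {a b : Fin k} (ha : r ≤ a) (hb : r ≤ b) :
    PairSortsTo (pairIndex k r ∘ exchange a b) (symmDiff S {lowerIndex k a, upperIndex k b})
      (symmDiff T {lowerIndex k a, upperIndex k b})
      ((-1) ^ (lowerIndex k a + upperIndex k b + r + 1 : ℕ)) := by
  have hu : pairIndex k r (inr b) = upperIndex k b := mixedIndex_of_le hb
  refine ⟨(-1) ^ (k - 1 - a : ℕ), (-1) ^ (b - r : ℕ), ?_, ?_, ?_⟩
  · rw [comp_exchange_comp_inl, hu]
    exact sortsTo_update_lowerIndex hS a b
  · rw [comp_exchange_comp_inr]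
    exact sortsTo_update_mixedIndex hr hT ha hb
  · rw [← pow_add]
    apply neg_one_pow_congr
    simp only [Nat.even_iff, coe_lowerIndex, coe_upperIndex]
    omega

lemma pairSortsTo_pairIndex_exchange_exchange {r : ℕ} (hr : r ≤ k) {S T : Finset (Fin (2 * k))}
    (hS : ∀ x, x ∈ S ↔ (x : ℕ) < k) (hT : ∀ x, x ∈ T ↔ (x : ℕ) < r ∨ k + r ≤ (x : ℕ))
    {a a' b b' : Fin k} (hra : r ≤ a) (hrb : r ≤ b) (ha : a < a') (hb : b < b') :
    PairSortsTo ((pairIndex k r ∘ exchange a b) ∘ exchange a' b')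
      (symmDiff S {lowerIndex k a, lowerIndex k a', upperIndex k b, upperIndex k b'})
      (symmDiff T {lowerIndex k a, lowerIndex k a', upperIndex k b, upperIndex k b'})
      ((-1) ^ (lowerIndex k a + lowerIndex k a' + upperIndex k b + upperIndex k b' : ℕ)) := by
  have hrb' : r ≤ b' := hrb.trans (Fin.le_def.1 hb.le)
  have hl : (pairIndex k r ∘ exchange a b) (inl a') = lowerIndex k a' := by
    simp [swap_apply_of_ne_of_ne, ha.ne', pairIndex]
  have hu : (pairIndex k r ∘ exchange a b) (inr b') = upperIndex k b' := by
    simp [swap_apply_of_ne_of_ne, hb.ne', pairIndex, mixedIndex_of_le hrb']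
  have hu₀ : pairIndex k r (inr b) = upperIndex k b := mixedIndex_of_le hrb
  refine ⟨(-1) ^ (a + a' + 1 : ℕ), (-1) ^ (b + b' + 1 : ℕ), ?_, ?_, ?_⟩
  · rw [comp_exchange_comp_inl, hu, comp_exchange_comp_inl, hu₀]
    exact sortsTo_update_update_lowerIndex hS ha hb
  · rw [comp_exchange_comp_inr, hl, comp_exchange_comp_inr]
    exact sortsTo_update_update_mixedIndex hr hT hra hrb ha hb
  · rw [← pow_add]
    apply neg_one_pow_congr
    simp only [Nat.even_iff, coe_lowerIndex, coe_upperIndex]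
    omega

end Sorting

section DoubleExchange

variable {m n ι : Type*} [LinearOrder ι]

lemma sum_ne_eq_two_mul_sum_lt (K : Finset ι) {h : ι → ι → ℝ}
    (hh : ∀ a b, a ≠ b → h a b = h b a) :
    ∑ a ∈ K, ∑ b ∈ K, (if a ≠ b then h a b else 0) =
      2 * ∑ a ∈ K, ∑ b ∈ K, if a < b then h a b else 0 := by
  have hsplit : ∀ a b, (if a ≠ b then h a b else 0) =
      (if a < b then h a b else 0) + if b < a then h b a else 0 := by
    intro a b
    rcases lt_trichotomy a b with hab | rfl | hab
    · simp [hab, hab.ne, hab.not_gt]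
    · simp
    · simp [hab, hab.ne', hab.not_gt, hh a b hab.ne']
  simp only [hsplit, Finset.sum_add_distrib]
  rw [Finset.sum_comm (f := fun a b => if b < a then h b a else 0)]
  ring

variable [Fintype ι]

lemma pairDet_comp_exchange_swap_left (A : Matrix m n ℝ) (w : ι ⊕ ι → m) (z : ι ⊕ ι → n)
    {a a' b b' : ι} (ha : a ≠ a') (hb : b ≠ b') :
    pairDet A ((w ∘ exchange a' b) ∘ exchange a b') z =
      pairDet A ((w ∘ exchange a b) ∘ exchange a' b') z := by
  have h : (w ∘ exchange a' b) ∘ exchange a b' =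
      ((w ∘ exchange a b) ∘ exchange a' b') ∘ Perm.sumCongr (swap a a') (swap b b') := by
    simp only [Function.comp_assoc, ← Perm.coe_mul, exchange_mul_exchange_swap ha hb, mul_assoc]
  rw [h, pairDet_comp_sumCongr, Perm.sign_swap ha, Perm.sign_swap hb]
  simp

lemma pairDet_comp_exchange_swap_right (A : Matrix m n ℝ) (w : ι ⊕ ι → m) (z : ι ⊕ ι → n)
    {a a' b b' : ι} (ha : a ≠ a') (hb : b ≠ b') :
    pairDet A ((w ∘ exchange a b') ∘ exchange a' b) z =
      pairDet A ((w ∘ exchange a b) ∘ exchange a' b') z := by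
  rw [← pairDet_comp_exchange_swap_left A w z ha hb]
  have h : Commute (exchange a b') (exchange a' b) :=
    (Perm.disjoint_swap_swap (by simp [ha, hb.symm])).commute
  simp only [Function.comp_assoc, ← Perm.coe_mul, h.eq]

lemma rowDoubleExchangeSum_eq_four_mul (K : Finset ι) (A : Matrix m n ℝ) (w : ι ⊕ ι → m)
    (z : ι ⊕ ι → n) :
    rowDoubleExchangeSum K A w z = 4 * ∑ a ∈ K, ∑ a' ∈ K with a < a', ∑ b ∈ K, ∑ b' ∈ K with b < b',
      pairDet A ((w ∘ exchange a b) ∘ exchange a' b') z := by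
  set H := fun a a' b b' => pairDet A ((w ∘ exchange a b) ∘ exchange a' b') z
  have hinner : ∀ a a', a ≠ a' → ∑ b ∈ K, ∑ b' ∈ K, (if b ≠ b' then H a a' b b' else 0) =
      2 * ∑ b ∈ K, ∑ b' ∈ K, if b < b' then H a a' b b' else 0 := fun a a' ha =>
    sum_ne_eq_two_mul_sum_lt K fun b b' hb =>
      (pairDet_comp_exchange_swap_right A w z ha hb).symm
  have houter := sum_ne_eq_two_mul_sum_lt K
    (h := fun a a' => ∑ b ∈ K, ∑ b' ∈ K, if b ≠ b' then H a a' b b' else 0) fun a a' ha =>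
      Finset.sum_congr rfl fun b _ => Finset.sum_congr rfl fun b' _ => by
        split_ifs with hb
        · exact (pairDet_comp_exchange_swap_left A w z ha hb).symm
        · rfl
  calc rowDoubleExchangeSum K A w z
      = ∑ a ∈ K, ∑ a' ∈ K, if a ≠ a' then
          ∑ b ∈ K, ∑ b' ∈ K, (if b ≠ b' then H a a' b b' else 0) else 0 := by
        refine Finset.sum_congr rfl fun a _ => ?_
        rw [Finset.sum_comm]
        refine Finset.sum_congr rfl fun a' _ => ?_
        split_ifs with ha <;> simp [H, ha]
    _ = _ := by
        rw [houter, show (4 : ℝ) = 2 * 2 by norm_num, mul_assoc]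
        congr 1
        simp only [Finset.sum_filter, Finset.mul_sum (s := K) (a := (2 : ℝ))]
        refine Finset.sum_congr rfl fun a _ => Finset.sum_congr rfl fun a' _ => ?_
        split_ifs with ha
        · rw [hinner a a' ha.ne, Finset.mul_sum]
        · simp

end DoubleExchange

section Assembly

variable {k : ℕ}

/-- The positions `a : Fin k` with `r ≤ a`, at which the tuples of `pairIndex k r` differ. -/
def tailPositions (k r : ℕ) : Finset (Fin k) := Finset.univ.filter fun a => r ≤ (a : ℕ)

lemma mem_tailPositions {r : ℕ} {a : Fin k} : a ∈ tailPositions k r ↔ r ≤ (a : ℕ) := by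
  simp [tailPositions]

lemma card_compl_tailPositions {r : ℕ} (hr : r ≤ k) : (tailPositions k r)ᶜ.card = r := by
  simp [tailPositions, Finset.compl_filter, Fin.card_filter_val_lt, hr]

lemma card_tailPositions {r : ℕ} (hr : r ≤ k) : ((tailPositions k r).card : ℝ) = k - r := by
  have h := Finset.card_add_card_compl (tailPositions k r)
  rw [card_compl_tailPositions hr, Fintype.card_fin] at h
  rw [eq_sub_iff_add_eq]
  exact_mod_cast h

lemma pairIndex_inl_eq_inr {r : ℕ} {a : Fin k} (ha : a ∉ tailPositions k r) :
    pairIndex k r (inl a) = pairIndex k r (inr a) := by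
  rw [mem_tailPositions, not_le] at ha
  simp [pairIndex, mixedIndex, ha]

lemma eq_map_lowerIndex {r : ℕ} {I : Finset (Fin (2 * k))}
    (hI : ∀ x, x ∈ I ↔ r ≤ (x : ℕ) ∧ (x : ℕ) < k) :
    I = (tailPositions k r).map (lowerIndex k) := by
  ext x
  simp only [hI, Finset.mem_map, mem_tailPositions, Fin.ext_iff, coe_lowerIndex]
  exact ⟨fun h => ⟨⟨x, h.2⟩, h.1, rfl⟩, fun ⟨a, ha, h⟩ => by omega⟩

lemma eq_map_upperIndex {r : ℕ} {I : Finset (Fin (2 * k))}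
    (hI : ∀ x, x ∈ I ↔ k + r ≤ (x : ℕ)) :
    I = (tailPositions k r).map (upperIndex k) := by
  ext x
  simp only [hI, Finset.mem_map, mem_tailPositions, Fin.ext_iff, coe_upperIndex]
  exact ⟨fun h => ⟨⟨x - k, by omega⟩, by simp; omega, by simp; omega⟩, fun ⟨a, ha, h⟩ => by omega⟩

lemma sum_map_filter_lt {α β : Type*} [LinearOrder α] [LinearOrder β] (K : Finset α) {e : α ↪ β}
    (he : StrictMono e) (a : α) (f : β → ℝ) :
    ∑ y ∈ (K.map e).filter (fun y => e a < y), f y = ∑ a' ∈ K with a < a', f (e a') := by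
  simp [Finset.sum_filter, he.lt_iff_lt]

lemma strictMono_upperIndex : StrictMono (upperIndex k) := by
  intro a b h
  rw [Fin.lt_def] at *
  simpa using h

variable (A : Matrix (Fin (2 * k)) (Fin (2 * k)) ℝ) {r c : ℕ}
  {S T I I' : Finset (Fin (2 * k))}

lemma rowExchangeSum_pairIndex (hr : r ≤ k) (hS : ∀ x, x ∈ S ↔ (x : ℕ) < k)
    (hT : ∀ x, x ∈ T ↔ (x : ℕ) < r ∨ k + r ≤ (x : ℕ))
    (hI : ∀ x, x ∈ I ↔ r ≤ (x : ℕ) ∧ (x : ℕ) < k) (hI' : ∀ x, x ∈ I' ↔ k + r ≤ (x : ℕ))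
    {z : Fin k ⊕ Fin k → Fin (2 * k)} {C D : Finset (Fin (2 * k))} (hz : PairSortsTo z C D 1) :
    rowExchangeSum (tailPositions k r) A (pairIndex k r) z =
      -((-1) ^ (k - r) * ∑ i ∈ I, ∑ i' ∈ I', (-1 : ℝ) ^ ((i : ℕ) + (i' : ℕ) + k) *
        (subdet A (symmDiff S {i, i'}) C * subdet A (symmDiff T {i, i'}) D)) := by
  rw [eq_map_lowerIndex hI, eq_map_upperIndex hI', rowExchangeSum]
  simp only [Finset.sum_map, Finset.mul_sum, ← Finset.sum_neg_distrib]
  refine Finset.sum_congr rfl fun a ha => Finset.sum_congr rfl fun b hb => ?_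
  rw [(pairSortsTo_pairIndex_exchange hr hS hT (mem_tailPositions.1 ha)
    (mem_tailPositions.1 hb)).pairDet A hz, ← mul_assoc ((-1) ^ (k - r)), ← pow_add, ← neg_mul,
    ← neg_one_mul ((-1 : ℝ) ^ _), ← pow_succ', mul_one]
  congr 1
  apply neg_one_pow_congr
  simp only [Nat.even_iff]
  omega

lemma colExchangeSum_pairIndex (hc : c ≤ k) (hS : ∀ x, x ∈ S ↔ (x : ℕ) < k)
    (hT : ∀ x, x ∈ T ↔ (x : ℕ) < c ∨ k + c ≤ (x : ℕ))
    (hI : ∀ x, x ∈ I ↔ c ≤ (x : ℕ) ∧ (x : ℕ) < k) (hI' : ∀ x, x ∈ I' ↔ k + c ≤ (x : ℕ))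
    {w : Fin k ⊕ Fin k → Fin (2 * k)} {C D : Finset (Fin (2 * k))} {ε : ℝ}
    (hw : PairSortsTo w C D ε) :
    colExchangeSum (tailPositions k c) A w (pairIndex k c) =
      -(ε * (-1) ^ (k - c) * ∑ i ∈ I, ∑ i' ∈ I', (-1 : ℝ) ^ ((i : ℕ) + (i' : ℕ) + k) *
        (subdet A C (symmDiff S {i, i'}) * subdet A D (symmDiff T {i, i'}))) := by
  rw [eq_map_lowerIndex hI, eq_map_upperIndex hI', colExchangeSum]
  simp only [Finset.sum_map, Finset.mul_sum, ← Finset.sum_neg_distrib]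
  refine Finset.sum_congr rfl fun a ha => Finset.sum_congr rfl fun b hb => ?_
  rw [hw.pairDet A (pairSortsTo_pairIndex_exchange hc hS hT (mem_tailPositions.1 ha)
    (mem_tailPositions.1 hb)), mul_assoc ε, mul_assoc ε, ← mul_neg, ← mul_assoc ((-1) ^ (k - c)),
    ← pow_add, ← neg_mul, ← neg_one_mul ((-1 : ℝ) ^ _), ← pow_succ']
  congr 2
  apply neg_one_pow_congr
  simp only [Nat.even_iff]
  omega

lemma sum_colExchangeSum_pairIndex (hr : r ≤ k) (hc : c ≤ k) {T' J J' : Finset (Fin (2 * k))}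
    (hS : ∀ x, x ∈ S ↔ (x : ℕ) < k) (hT : ∀ x, x ∈ T ↔ (x : ℕ) < r ∨ k + r ≤ (x : ℕ))
    (hT' : ∀ x, x ∈ T' ↔ (x : ℕ) < c ∨ k + c ≤ (x : ℕ))
    (hI : ∀ x, x ∈ I ↔ r ≤ (x : ℕ) ∧ (x : ℕ) < k) (hI' : ∀ x, x ∈ I' ↔ k + r ≤ (x : ℕ))
    (hJ : ∀ x, x ∈ J ↔ c ≤ (x : ℕ) ∧ (x : ℕ) < k) (hJ' : ∀ x, x ∈ J' ↔ k + c ≤ (x : ℕ)) :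
    ∑ a ∈ tailPositions k r, ∑ b ∈ tailPositions k r,
        colExchangeSum (tailPositions k c) A (pairIndex k r ∘ exchange a b) (pairIndex k c) =
      (-1) ^ (r + c) * ∑ i ∈ I, ∑ j ∈ J, ∑ i' ∈ I', ∑ j' ∈ J',
        (-1 : ℝ) ^ ((i : ℕ) + (j : ℕ) + (i' : ℕ) + (j' : ℕ)) *
          (subdet A (symmDiff S {i, i'}) (symmDiff S {j, j'}) *
            subdet A (symmDiff T {i, i'}) (symmDiff T' {j, j'})) := by
  rw [eq_map_lowerIndex hI, eq_map_upperIndex hI', Finset.mul_sum, Finset.sum_map]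
  refine Finset.sum_congr rfl fun a ha => ?_
  rw [Finset.sum_comm, Finset.mul_sum, Finset.sum_map]
  refine Finset.sum_congr rfl fun b hb => ?_
  rw [colExchangeSum_pairIndex A hc hS hT' hJ hJ' (pairSortsTo_pairIndex_exchange hr hS hT
    (mem_tailPositions.1 ha) (mem_tailPositions.1 hb))]
  simp only [Finset.mul_sum, ← Finset.sum_neg_distrib]
  refine Finset.sum_congr rfl fun j _ => Finset.sum_congr rfl fun j' _ => ?_
  rw [← mul_assoc, ← mul_assoc ((-1) ^ (r + c)), ← pow_add, ← pow_add, ← pow_add, ← neg_mul,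
    ← neg_one_mul ((-1 : ℝ) ^ _), ← pow_succ']
  congr 1
  apply neg_one_pow_congr
  simp only [Nat.even_iff]
  omega

lemma rowDoubleExchangeSum_pairIndex (hr : r ≤ k) (hS : ∀ x, x ∈ S ↔ (x : ℕ) < k)
    (hT : ∀ x, x ∈ T ↔ (x : ℕ) < r ∨ k + r ≤ (x : ℕ))
    (hI : ∀ x, x ∈ I ↔ r ≤ (x : ℕ) ∧ (x : ℕ) < k) (hI' : ∀ x, x ∈ I' ↔ k + r ≤ (x : ℕ))
    {z : Fin k ⊕ Fin k → Fin (2 * k)} {C D : Finset (Fin (2 * k))} (hz : PairSortsTo z C D 1) :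
    rowDoubleExchangeSum (tailPositions k r) A (pairIndex k r) z =
      4 * ∑ i ∈ I, ∑ h ∈ I.filter (fun h => i < h), ∑ i' ∈ I', ∑ h' ∈ I'.filter (fun h' => i' < h'),
        (-1 : ℝ) ^ ((i : ℕ) + (h : ℕ) + (i' : ℕ) + (h' : ℕ)) *
          (subdet A (symmDiff S {i, h, i', h'}) C * subdet A (symmDiff T {i, h, i', h'}) D) := by
  rw [rowDoubleExchangeSum_eq_four_mul, eq_map_lowerIndex hI, eq_map_upperIndex hI']
  simp only [Finset.sum_map, sum_map_filter_lt _ strictMono_lowerIndex,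
    sum_map_filter_lt _ strictMono_upperIndex]
  congr 1
  refine Finset.sum_congr rfl fun a ha => Finset.sum_congr rfl fun a' ha' =>
    Finset.sum_congr rfl fun b hb => Finset.sum_congr rfl fun b' hb' => ?_
  rw [(pairSortsTo_pairIndex_exchange_exchange hr hS hT (mem_tailPositions.1 ha)
    (mem_tailPositions.1 hb) (Finset.mem_filter.1 ha').2 (Finset.mem_filter.1 hb').2).pairDet A hz,
    mul_one]

lemma subdet_transpose {M N : ℕ} (B : Matrix (Fin M) (Fin N) ℝ) {R : Finset (Fin M)}
    {C : Finset (Fin N)} : subdet B.transpose C R = subdet B R C := by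
  unfold subdet
  by_cases h : R.card = C.card
  · rw [dif_pos h, dif_pos h.symm, ← Matrix.det_transpose, Matrix.transpose_submatrix,
      Matrix.transpose_transpose]
    have key : ∀ (p q : ℕ) (e : p = q) (h₁ : R.card = p) (h₂ : C.card = p) (h₃ : R.card = q)
        (h₄ : C.card = q), (B.submatrix (R.orderEmbOfFin h₁) (C.orderEmbOfFin h₂)).det =
          (B.submatrix (R.orderEmbOfFin h₃) (C.orderEmbOfFin h₄)).det := by
      rintro p _ rfl _ _ _ _
      rfl
    exact key _ _ h.symm _ _ _ _
  · rw [dif_neg h, dif_neg (Ne.symm h)]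

end Assembly

/-- **Extended Plücker relation, general case, summed form** (Lemma 5.4, equation (7)).
Setup as in the first equation (0-based indexing by `Fin (2k)` preserves all sign
parities). Then `((k−r)² + (k−c)² + (r−c)²)·[S_R,S_C]·[T_R,T_C]
= 2s₁ − 2(k−1+r−2c)·ŝ₂ − 2(k−1+c−2r)·s₂ − 4(s₃ + ŝ₃)`. -/
theorem extended_plucker_general_summed {k : ℕ} (hk : 1 ≤ k) (r c : ℕ) (hr : r ≤ k) (hc : c ≤ k)
    (A : Matrix (Fin (2 * k)) (Fin (2 * k)) ℝ)
    (SR TR TC RS RT CS CT : Finset (Fin (2 * k)))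
    (hSR : ∀ x, x ∈ SR ↔ (x : ℕ) < k)
    (hTR : ∀ x, x ∈ TR ↔ ((x : ℕ) < r ∨ k + r ≤ (x : ℕ)))
    (hTC : ∀ x, x ∈ TC ↔ ((x : ℕ) < c ∨ k + c ≤ (x : ℕ)))
    (hRS : ∀ x, x ∈ RS ↔ (r ≤ (x : ℕ) ∧ (x : ℕ) < k))
    (hRT : ∀ x, x ∈ RT ↔ k + r ≤ (x : ℕ))
    (hCS : ∀ x, x ∈ CS ↔ (c ≤ (x : ℕ) ∧ (x : ℕ) < k))
    (hCT : ∀ x, x ∈ CT ↔ k + c ≤ (x : ℕ))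
    (s1 s2 s2h s3 s3h : ℝ)
    (hs1 : s1 = (-1 : ℝ) ^ (r + c) * ∑ i ∈ RS, ∑ j ∈ CS, ∑ i' ∈ RT, ∑ j' ∈ CT,
      (-1 : ℝ) ^ ((i : ℕ) + (j : ℕ) + (i' : ℕ) + (j' : ℕ)) *
        (subdet A (symmDiff SR {i, i'}) (symmDiff SR {j, j'}) *
          subdet A (symmDiff TR {i, i'}) (symmDiff TC {j, j'})))
    (hs2 : s2 = (-1 : ℝ) ^ (k - r) * ∑ i ∈ RS, ∑ i' ∈ RT,
      (-1 : ℝ) ^ ((i : ℕ) + (i' : ℕ) + k) *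
        (subdet A (symmDiff SR {i, i'}) SR * subdet A (symmDiff TR {i, i'}) TC))
    (hs2h : s2h = (-1 : ℝ) ^ (k - c) * ∑ j ∈ CS, ∑ j' ∈ CT,
      (-1 : ℝ) ^ ((j : ℕ) + (j' : ℕ) + k) *
        (subdet A SR (symmDiff SR {j, j'}) * subdet A TR (symmDiff TC {j, j'})))
    (hs3 : s3 = ∑ i ∈ RS, ∑ h ∈ RS.filter (fun h => i < h),
        ∑ i' ∈ RT, ∑ h' ∈ RT.filter (fun h' => i' < h'),
      (-1 : ℝ) ^ ((i : ℕ) + (h : ℕ) + (i' : ℕ) + (h' : ℕ)) *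
        (subdet A (symmDiff SR {i, h, i', h'}) SR *
          subdet A (symmDiff TR {i, h, i', h'}) TC))
    (hs3h : s3h = ∑ j ∈ CS, ∑ l ∈ CS.filter (fun l => j < l),
        ∑ j' ∈ CT, ∑ l' ∈ CT.filter (fun l' => j' < l'),
      (-1 : ℝ) ^ ((j : ℕ) + (l : ℕ) + (j' : ℕ) + (l' : ℕ)) *
        (subdet A SR (symmDiff SR {j, l, j', l'}) *
          subdet A TR (symmDiff TC {j, l, j', l'}))) :
    (((k : ℝ) - r) ^ 2 + ((k : ℝ) - c) ^ 2 + ((r : ℝ) - c) ^ 2) *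
        (subdet A SR SR * subdet A TR TC) =
      2 * s1 - 2 * ((k : ℝ) - 1 + (r : ℝ) - 2 * c) * s2h
        - 2 * ((k : ℝ) - 1 + (c : ℝ) - 2 * r) * s2 - 4 * (s3 + s3h) := by
  have hw := pairSortsTo_pairIndex hr hSR hTR
  have hz := pairSortsTo_pairIndex hc hSR hTC
  have hX := hw.pairDet A hz
  have h1 := sum_colExchangeSum_pairIndex A hr hc hSR hTR hTC hRS hRT hCS hCT
  have h2 := rowExchangeSum_pairIndex A hr hSR hTR hRS hRT hz
  have h2h := colExchangeSum_pairIndex A hc hSR hTC hCS hCT hw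
  have h3 := rowDoubleExchangeSum_pairIndex A hr hSR hTR hRS hRT hz
  have h3h := rowDoubleExchangeSum_pairIndex A.transpose hc hSR hTC hCS hCT hw
  simp only [subdet_transpose] at h3h
  rw [one_mul] at h2h
  rw [← hs1] at h1
  rw [← hs2] at h2
  rw [← hs2h] at h2h
  rw [← hs3] at h3
  rw [← hs3h] at h3h
  have hsingle := rowExchangeSum_add_eq_colExchangeSum_add (A := A)
    (fun a => pairIndex_inl_eq_inr (k := k) (r := r) (a := a))
    (fun a => pairIndex_inl_eq_inr (k := k) (r := c) (a := a))
  have hdouble := exchange_relation (A := A)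
    (fun a => pairIndex_inl_eq_inr (k := k) (r := r) (a := a))
    (fun a => pairIndex_inl_eq_inr (k := k) (r := c) (a := a)) rfl rfl
  simp only [card_compl_tailPositions, hr, hc, card_tailPositions, h1, h2, h2h, h3, h3h, hX]
    at hsingle hdouble
  linear_combination hdouble + 2 * ((r : ℝ) - c) * hsingle
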